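/- arXiv:1612.05099 — 2 statements merged into one kernel-verified Lean document; each statement's English description precedes it below -/
import Mathlib

section
/- Let (λ_x, Δ_x) be a type datum on H_x and (λ_y, Δ_y) a type datum on H_y, with deterministic sets D_x and D_y. Then the set of PSD operators on H_x⊗H_y lying in the affine span (over ℝ, inside the Hermitian operators on H_x⊗H_y) of { X⊗Y : X ∈ D_x, Y ∈ D_y } equals { G : G PSD on H_x⊗H_y and G − λ_x·λ_y·I ∈ (Δ_x⊗Γ_{H_y}) + (Γ_{H_x}⊗Δ_y) + (Δ_x⊗Δ_y) }. -/
open Matrix Kronecker ComplexOrder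

noncomputable section

/-- The deterministic set `D(λ,Δ)` of a type datum `(λ,Δ)`: positive semidefinite operators
`X` with `X − λ·I ∈ Δ`. -/
def detSet {ι : Type*} [Fintype ι] [DecidableEq ι] (lam : ℝ) (Δ : Set (Matrix ι ι ℂ)) :
    Set (Matrix ι ι ℂ) :=
  {X | X.PosSemidef ∧ X - lam • (1 : Matrix ι ι ℂ) ∈ Δ}

/-- `V⊗W`: the ℝ-span of `{v ⊗ w : v ∈ V, w ∈ W}` inside the operators on `H_x⊗H_y`. -/
def tensSpan {α β : Type*} (V : Set (Matrix α α ℂ)) (W : Set (Matrix β β ℂ)) :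
    Submodule ℝ (Matrix (α × β) (α × β) ℂ) :=
  Submodule.span ℝ (Set.image2 (· ⊗ₖ ·) V W)

/-- `Γ_H = ℝ·I` as a set of operators. -/
def gammaSet (ι : Type*) [Fintype ι] [DecidableEq ι] : Set (Matrix ι ι ℂ) :=
  (Submodule.span ℝ {(1 : Matrix ι ι ℂ)} : Submodule ℝ (Matrix ι ι ℂ))


section helper
open scoped MatrixOrder Matrix.Norms.L2Operator

theorem aux_shift {ι : Type} [Fintype ι] [DecidableEq ι] (T : Matrix ι ι ℂ)
    (hT : T.IsHermitian) : ∃ r : ℝ, 0 < r ∧ (r • (1 : Matrix ι ι ℂ) + T).PosSemidef := by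
  have h := IsSelfAdjoint.neg_algebraMap_norm_le_self (A := Matrix ι ι ℂ) (a := T) hT
  refine ⟨‖T‖ + 1, by positivity, ?_⟩
  rw [← Matrix.nonneg_iff_posSemidef]
  rw [neg_le_iff_add_nonneg', Algebra.algebraMap_eq_smul_one] at h
  have h1 : (0 : Matrix ι ι ℂ) ≤ 1 := Matrix.nonneg_iff_posSemidef.2 Matrix.PosSemidef.one
  have h2 := add_nonneg h h1
  convert h2 using 1
  rw [add_smul, one_smul]; abel

end helper

theorem aux_eps {ι : Type} [Fintype ι] [DecidableEq ι] (lam : ℝ) (hl : 0 < lam)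
    (Δ : Submodule ℝ (Matrix ι ι ℂ)) (T : Matrix ι ι ℂ)
    (hT : T.IsHermitian) (hm : T ∈ Δ) :
    ∃ e : ℝ, e ≠ 0 ∧ lam • (1 : Matrix ι ι ℂ) + e • T ∈ detSet lam (Δ : Set (Matrix ι ι ℂ)) := by
  obtain ⟨r, hr, h⟩ := aux_shift T hT
  refine ⟨lam / r, by positivity, ?_, ?_⟩
  · have h3 := h.smul (show (0 : ℝ) ≤ lam / r by positivity)
    rw [smul_add, smul_smul, div_mul_cancel₀ _ hr.ne'] at h3
    exact h3
  · rw [add_sub_cancel_left]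
    exact Δ.smul_mem _ hm

theorem aux_one {ι : Type} [Fintype ι] [DecidableEq ι] (lam : ℝ) (hl : 0 < lam)
    (Δ : Submodule ℝ (Matrix ι ι ℂ)) :
    lam • (1 : Matrix ι ι ℂ) ∈ detSet lam (Δ : Set (Matrix ι ι ℂ)) := by
  refine ⟨Matrix.PosSemidef.one.smul hl.le, ?_⟩
  rw [sub_self]; exact Δ.zero_mem

/-- PSD operators in the affine span of `{X⊗Y : X ∈ D_x, Y ∈ D_y}` are exactly
`{G PSD | G − λ_x·λ_y·I ∈ (Δ_x⊗Γ_y) + (Γ_x⊗Δ_y) + (Δ_x⊗Δ_y)}`. -/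
theorem stmt_11 {ιx ιy : Type} [Fintype ιx] [DecidableEq ιx] [Nonempty ιx]
    [Fintype ιy] [DecidableEq ιy] [Nonempty ιy]
    (lamx lamy : ℝ) (hlamx : 0 < lamx) (hlamy : 0 < lamy)
    (Δx : Submodule ℝ (Matrix ιx ιx ℂ)) (Δy : Submodule ℝ (Matrix ιy ιy ℂ))
    (hΔx : ∀ T ∈ Δx, T.IsHermitian ∧ T.trace = 0)
    (hΔy : ∀ T ∈ Δy, T.IsHermitian ∧ T.trace = 0) :
    {G : Matrix (ιx × ιy) (ιx × ιy) ℂ | G.PosSemidef ∧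
        G ∈ affineSpan ℝ (Set.image2 (· ⊗ₖ ·)
              (detSet lamx (Δx : Set (Matrix ιx ιx ℂ)))
              (detSet lamy (Δy : Set (Matrix ιy ιy ℂ))))} =
      {G : Matrix (ιx × ιy) (ιx × ιy) ℂ | G.PosSemidef ∧
        G - (lamx * lamy) • (1 : Matrix (ιx × ιy) (ιx × ιy) ℂ) ∈
          (tensSpan (Δx : Set _) (gammaSet ιy) ⊔ tensSpan (gammaSet ιx) (Δy : Set _) ⊔
           tensSpan (Δx : Set _) (Δy : Set _) :
             Submodule ℝ (Matrix (ιx × ιy) (ιx × ιy) ℂ))} := by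
  set S : Submodule ℝ (Matrix (ιx × ιy) (ιx × ιy) ℂ) :=
    tensSpan (Δx : Set _) (gammaSet ιy) ⊔ tensSpan (gammaSet ιx) (Δy : Set _) ⊔
           tensSpan (Δx : Set _) (Δy : Set _) with hS
  set D := Set.image2 (· ⊗ₖ ·) (detSet lamx (Δx : Set (Matrix ιx ιx ℂ)))
              (detSet lamy (Δy : Set (Matrix ιy ιy ℂ))) with hD
  have hc : (lamx • (1 : Matrix ιx ιx ℂ)) ⊗ₖ (lamy • (1 : Matrix ιy ιy ℂ)) =
      (lamx * lamy) • (1 : Matrix (ιx × ιy) (ιx × ιy) ℂ) := by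
    rw [Matrix.smul_kronecker, Matrix.kronecker_smul, Matrix.one_kronecker_one, smul_smul]
  have hSxy : ∀ A ∈ Δx, ∀ B ∈ Δy, A ⊗ₖ B ∈ S := fun A hA B hB =>
    (le_sup_right : _ ≤ S) (Submodule.subset_span ⟨A, hA, B, hB, rfl⟩)
  have hSx : ∀ A ∈ Δx, A ⊗ₖ (1 : Matrix ιy ιy ℂ) ∈ S := fun A hA =>
    (le_sup_of_le_left le_sup_left : tensSpan (Δx : Set _) (gammaSet ιy) ≤ S)
      (Submodule.subset_span ⟨A, hA, 1, Submodule.mem_span_singleton_self _, rfl⟩)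
  have hSy : ∀ B ∈ Δy, (1 : Matrix ιx ιx ℂ) ⊗ₖ B ∈ S := fun B hB =>
    (le_sup_of_le_left le_sup_right : tensSpan (gammaSet ιx) (Δy : Set _) ≤ S)
      (Submodule.subset_span ⟨1, Submodule.mem_span_singleton_self _, B, hB, rfl⟩)
  have hone : (lamx * lamy) • (1 : Matrix (ιx × ιy) (ιx × ιy) ℂ) ∈ affineSpan ℝ D := by
    rw [← hc]
    exact subset_affineSpan ℝ _ ⟨_, aux_one lamx hlamx Δx, _, aux_one lamy hlamy Δy, rfl⟩
  have hdir : ∀ X ∈ detSet lamx (Δx : Set (Matrix ιx ιx ℂ)),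
      ∀ Y ∈ detSet lamy (Δy : Set (Matrix ιy ιy ℂ)),
      X ⊗ₖ Y - (lamx * lamy) • (1 : Matrix (ιx × ιy) (ιx × ιy) ℂ) ∈
        (affineSpan ℝ D).direction := fun X hX Y hY =>
    AffineSubspace.vsub_mem_direction (subset_affineSpan ℝ _ ⟨X, hX, Y, hY, rfl⟩) hone
  have hdx : ∀ A ∈ Δx, A ⊗ₖ (1 : Matrix ιy ιy ℂ) ∈ (affineSpan ℝ D).direction := by
    intro A hA
    obtain ⟨e, he, h⟩ := aux_eps lamx hlamx Δx A (hΔx A hA).1 hA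
    have h1 := hdir _ h _ (aux_one lamy hlamy Δy)
    rw [Matrix.add_kronecker, hc, add_sub_cancel_left, Matrix.smul_kronecker,
      Matrix.kronecker_smul, smul_smul] at h1
    exact (Submodule.smul_mem_iff _ (mul_ne_zero he hlamy.ne')).1 h1
  have hdy : ∀ B ∈ Δy, (1 : Matrix ιx ιx ℂ) ⊗ₖ B ∈ (affineSpan ℝ D).direction := by
    intro B hB
    obtain ⟨e, he, h⟩ := aux_eps lamy hlamy Δy B (hΔy B hB).1 hB
    have h1 := hdir _ (aux_one lamx hlamx Δx) _ h
    rw [Matrix.kronecker_add, hc, add_sub_cancel_left, Matrix.smul_kronecker,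
      Matrix.kronecker_smul, smul_smul] at h1
    exact (Submodule.smul_mem_iff _ (mul_ne_zero hlamx.ne' he)).1 h1
  have hdxy : ∀ A ∈ Δx, ∀ B ∈ Δy, A ⊗ₖ B ∈ (affineSpan ℝ D).direction := by
    intro A hA B hB
    obtain ⟨e, he, h⟩ := aux_eps lamx hlamx Δx A (hΔx A hA).1 hA
    obtain ⟨d, hd, h'⟩ := aux_eps lamy hlamy Δy B (hΔy B hB).1 hB
    have h1 := hdir _ h _ h'
    rw [Matrix.add_kronecker, Matrix.kronecker_add, Matrix.kronecker_add, hc, add_assoc,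
      add_sub_cancel_left] at h1
    simp only [Matrix.smul_kronecker, Matrix.kronecker_smul, smul_smul] at h1
    rw [Submodule.add_mem_iff_right _ (Submodule.smul_mem _ _ (hdy B hB)),
      Submodule.add_mem_iff_right _ (Submodule.smul_mem _ _ (hdx A hA))] at h1
    first
    | exact (Submodule.smul_mem_iff _ (mul_ne_zero he hd)).1 h1
    | exact (Submodule.smul_mem_iff _ (mul_ne_zero hd he)).1 h1
  have hSle : S ≤ (affineSpan ℝ D).direction := by
    refine sup_le (sup_le ?_ ?_) ?_ <;> refine Submodule.span_le.2 ?_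
    · rintro _ ⟨A, hA, B, hB, rfl⟩
      obtain ⟨c, rfl⟩ := Submodule.mem_span_singleton.1 hB
      simp only [Matrix.kronecker_smul]
      exact Submodule.smul_mem _ _ (hdx A hA)
    · rintro _ ⟨A, hA, B, hB, rfl⟩
      obtain ⟨c, rfl⟩ := Submodule.mem_span_singleton.1 hA
      simp only [Matrix.smul_kronecker]
      exact Submodule.smul_mem _ _ (hdy B hB)
    · rintro _ ⟨A, hA, B, hB, rfl⟩
      exact hdxy A hA B hB
  have hle : affineSpan ℝ D ≤
      AffineSubspace.mk' ((lamx * lamy) • (1 : Matrix (ιx × ιy) (ιx × ιy) ℂ)) S := by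
    refine affineSpan_le.2 ?_
    rintro _ ⟨X, ⟨-, hX⟩, Y, ⟨-, hY⟩, rfl⟩
    rw [SetLike.mem_coe, AffineSubspace.mem_mk', vsub_eq_sub]
    obtain ⟨A, rfl⟩ : ∃ A, X = lamx • 1 + A := ⟨X - lamx • 1, by abel⟩
    obtain ⟨B, rfl⟩ : ∃ B, Y = lamy • 1 + B := ⟨Y - lamy • 1, by abel⟩
    rw [add_sub_cancel_left] at hX hY
    simp only
    rw [Matrix.add_kronecker, Matrix.kronecker_add, Matrix.kronecker_add, hc, add_assoc,
      add_sub_cancel_left]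
    simp only [Matrix.smul_kronecker, Matrix.kronecker_smul]
    exact S.add_mem (S.smul_mem _ (hSy B hY))
      (S.add_mem (S.smul_mem _ (hSx A hX)) (hSxy A hX B hY))
  ext G
  refine and_congr_right fun _ => ⟨fun h => ?_, fun h => ?_⟩
  · have := hle h
    rwa [AffineSubspace.mem_mk', vsub_eq_sub] at this
  · have := AffineSubspace.vadd_mem_of_mem_direction (hSle h) hone
    rwa [vadd_eq_add, sub_add_cancel] at this


end
end

section
/- Let λ > 0 and let Δ_x and Δ_y be ℝ-linear subspaces of the traceless Hermitian operators on a finite-dimensional Hilbert space H, and set λ̄ := 1/(λ·dim H). Then { Y : Y PSD on H and Y − λ̄·I ∈ Δ̄_x + Δ̄_y } equals the set of PSD operators on H lying in the affine span (over ℝ, inside the Hermitian operators on H) of D(λ̄, Δ̄_x) ∪ D(λ̄, Δ̄_y). -/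
open Matrix Kronecker ComplexOrder

noncomputable section

/-- `Δ̄`: the orthogonal complement of `ℝ·I ⊕ Δ` inside the Hermitian operators on `H`,
with respect to the Hilbert–Schmidt inner product `⟪A,B⟫ = Tr[AB]`. -/
def hermComp {ι : Type*} [Fintype ι] [DecidableEq ι] (Δ : Submodule ℝ (Matrix ι ι ℂ)) :
    Set (Matrix ι ι ℂ) :=
  {Y | Y.IsHermitian ∧
    ∀ X ∈ (Submodule.span ℝ {(1 : Matrix ι ι ℂ)} ⊔ Δ : Submodule ℝ (Matrix ι ι ℂ)),
      (X * Y).trace = 0}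

open scoped MatrixOrder Matrix.Norms.L2Operator in
lemma exists_eps_psd {ι : Type*} [Fintype ι] [DecidableEq ι] (c : ℝ) (hc : 0 < c)
    (T : Matrix ι ι ℂ) (hT : T.IsHermitian) :
    ∃ e : ℝ, 0 < e ∧ (c • (1 : Matrix ι ι ℂ) + e • T).PosSemidef := by
  have h1 : IsSelfAdjoint T := hT
  have h2 := h1.neg_algebraMap_norm_le_self
  rw [Matrix.le_iff, Algebra.algebraMap_eq_smul_one] at h2
  have hpos : 0 < ‖T‖ + 1 := by positivity
  refine ⟨c / (‖T‖ + 1), by positivity, ?_⟩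
  have h3 : (c • (1 : Matrix ι ι ℂ) + (c / (‖T‖ + 1)) • T) =
      (c / (‖T‖ + 1)) • (T - -(‖T‖ • (1 : Matrix ι ι ℂ))) + (c / (‖T‖ + 1)) • 1 := by
    have : c = (c / (‖T‖ + 1)) * ‖T‖ + c / (‖T‖ + 1) := by field_simp
    conv_lhs => rw [this]
    rw [← this]
    nth_rewrite 1 [this]
    module
  rw [h3]
  have he : 0 ≤ c / (‖T‖ + 1) := by positivity
  exact (h2.smul he).add (Matrix.PosSemidef.one.smul he)

lemma psd_part {ι : Type*} [Fintype ι] [DecidableEq ι] (c : ℝ) (hc : 0 < c)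
    (Δ : Submodule ℝ (Matrix ι ι ℂ)) (T : Matrix ι ι ℂ) (hT : T ∈ hermComp Δ) :
    ∃ e : ℝ, 0 < e ∧ c • (1 : Matrix ι ι ℂ) + e • T ∈ detSet c (hermComp Δ) := by
  obtain ⟨e, he, hp⟩ := exists_eps_psd c hc T hT.1
  refine ⟨e, he, hp, ?_⟩
  rw [add_sub_cancel_left]
  refine ⟨?_, fun X hX => ?_⟩
  · have := hT.1
    unfold Matrix.IsHermitian at *
    rw [Matrix.conjTranspose_smul, this]; simp
  · rw [Matrix.mul_smul, Matrix.trace_smul, hT.2 X hX, smul_zero]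

/-- with `λ̄ := 1/(λ·dim H)`, the set
`{Y PSD | Y − λ̄·I ∈ Δ̄_x + Δ̄_y}` equals the set of PSD operators lying in the affine span
of `D(λ̄,Δ̄_x) ∪ D(λ̄,Δ̄_y)`. -/
theorem stmt_15 {ι : Type} [Fintype ι] [DecidableEq ι] [Nonempty ι]
    (lam : ℝ) (hlam : 0 < lam)
    (Δx Δy : Submodule ℝ (Matrix ι ι ℂ))
    (hΔx : ∀ T ∈ Δx, T.IsHermitian ∧ T.trace = 0)
    (hΔy : ∀ T ∈ Δy, T.IsHermitian ∧ T.trace = 0) :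
    {Y : Matrix ι ι ℂ | Y.PosSemidef ∧
        Y - (1 / (lam * (Fintype.card ι : ℝ))) • (1 : Matrix ι ι ℂ) ∈
          Submodule.span ℝ (hermComp Δx ∪ hermComp Δy)} =
      {Y : Matrix ι ι ℂ | Y.PosSemidef ∧
        Y ∈ affineSpan ℝ (detSet (1 / (lam * (Fintype.card ι : ℝ))) (hermComp Δx) ∪
                          detSet (1 / (lam * (Fintype.card ι : ℝ))) (hermComp Δy))} := by
  have hc : 0 < 1 / (lam * (Fintype.card ι : ℝ)) := by
    have : 0 < (Fintype.card ι : ℝ) := by exact_mod_cast Fintype.card_pos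
    positivity
  generalize 1 / (lam * (Fintype.card ι : ℝ)) = c at hc
  have hbase : c • (1 : Matrix ι ι ℂ) ∈ affineSpan ℝ
      (detSet c (hermComp Δx) ∪ detSet c (hermComp Δy)) := by
    obtain ⟨e, he, h⟩ := psd_part c hc Δx 0 ⟨by simp, by simp⟩
    rw [smul_zero, add_zero] at h
    exact subset_affineSpan ℝ _ (Or.inl h)
  ext Y
  refine and_congr_right fun _ => ⟨fun h => ?_, fun h => ?_⟩
  · have hle : Submodule.span ℝ (hermComp Δx ∪ hermComp Δy) ≤
        (affineSpan ℝ (detSet c (hermComp Δx) ∪ detSet c (hermComp Δy))).direction := by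
      rw [Submodule.span_le]
      intro T hT
      have : ∃ e : ℝ, 0 < e ∧ c • (1 : Matrix ι ι ℂ) + e • T ∈
          detSet c (hermComp Δx) ∪ detSet c (hermComp Δy) := by
        rcases hT with hT | hT
        · obtain ⟨e, he, h⟩ := psd_part c hc _ T hT
          exact ⟨e, he, Or.inl h⟩
        · obtain ⟨e, he, h⟩ := psd_part c hc _ T hT
          exact ⟨e, he, Or.inr h⟩
      obtain ⟨e, he, h⟩ := this
      have h2 := AffineSubspace.vsub_mem_direction (subset_affineSpan ℝ _ h) hbase
      rw [vsub_eq_sub, add_sub_cancel_left] at h2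
      exact (Submodule.smul_mem_iff _ he.ne').1 h2
    have h3 := AffineSubspace.vadd_mem_of_mem_direction (hle h) hbase
    simpa using h3
  · have hle : affineSpan ℝ (detSet c (hermComp Δx) ∪ detSet c (hermComp Δy)) ≤
        AffineSubspace.mk' (c • (1 : Matrix ι ι ℂ))
          (Submodule.span ℝ (hermComp Δx ∪ hermComp Δy)) := by
      rw [affineSpan_le]
      intro X hX
      rw [SetLike.mem_coe, AffineSubspace.mem_mk', vsub_eq_sub]
      apply Submodule.subset_span
      rcases hX with hX | hX
      · exact Or.inl hX.2
      · exact Or.inr hX.2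
    have h3 := hle h
    rwa [AffineSubspace.mem_mk', vsub_eq_sub] at h3

end
end
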